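/- For every h ∈ G fixing the two one-letter words [0] and [1], the sections h₀ and h₁ belong to G. Moreover, for every g ∈ G there exists h ∈ G fixing [0] and [1] with h₀ = g, and there exists h' ∈ G fixing [0] and [1] with h'₁ = g. -/

import Mathlib

namespace Grig

def aFun : List Bool → List Bool
  | [] => []
  | x :: v => (!x) :: v

mutual
  def bFun : List Bool → List Bool
    | [] => []
    | false :: v => false :: aFun v
    | true :: v => true :: cFun v
  def cFun : List Bool → List Bool
    | [] => []
    | false :: v => false :: aFun v
    | true :: v => true :: dFun v
  def dFun : List Bool → List Bool
    | [] => []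
    | false :: v => false :: v
    | true :: v => true :: bFun v
end

theorem aFun_invol : Function.Involutive aFun := by
  intro v; cases v <;> simp [aFun]

theorem bcd_invol : ∀ v, bFun (bFun v) = v ∧ cFun (cFun v) = v ∧ dFun (dFun v) = v := by
  intro v
  induction v with
  | nil => simp [bFun, cFun, dFun]
  | cons x v ih =>
    cases x <;> simp [bFun, cFun, dFun, aFun_invol v, ih.1, ih.2.1, ih.2.2]

/-- The automorphism `a` of the binary tree. -/
def a : Equiv.Perm (List Bool) := Function.Involutive.toPerm aFun aFun_invol

def b : Equiv.Perm (List Bool) := Function.Involutive.toPerm bFun (fun v => (bcd_invol v).1)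

def c : Equiv.Perm (List Bool) := Function.Involutive.toPerm cFun (fun v => (bcd_invol v).2.1)

def d : Equiv.Perm (List Bool) := Function.Involutive.toPerm dFun (fun v => (bcd_invol v).2.2)

/-- The Grigorchuk group, as the subgroup generated by `a, b, c, d` inside the
permutation group of the vertex set of the binary tree. -/
def grigG : Subgroup (Equiv.Perm (List Bool)) := Subgroup.closure {a, b, c, d}

end Grig

namespace Grig

theorem mem_a : a ∈ grigG := Subgroup.subset_closure (by simp)
theorem mem_b : b ∈ grigG := Subgroup.subset_closure (by simp)
theorem mem_c : c ∈ grigG := Subgroup.subset_closure (by simp)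
theorem mem_d : d ∈ grigG := Subgroup.subset_closure (by simp)

theorem a_cons (x : Bool) (w : List Bool) : a (x :: w) = (!x) :: w := rfl
theorem b_false (w : List Bool) : b (false :: w) = false :: a w := by
  show bFun _ = _
  rw [bFun]; rfl
theorem b_true (w : List Bool) : b (true :: w) = true :: c w := by
  show bFun _ = _
  rw [bFun]; rfl
theorem c_false (w : List Bool) : c (false :: w) = false :: a w := by
  show cFun _ = _
  rw [cFun]; rfl
theorem c_true (w : List Bool) : c (true :: w) = true :: d w := by
  show cFun _ = _
  rw [cFun]; rfl
theorem d_false (w : List Bool) : d (false :: w) = false :: w := by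
  show dFun _ = _
  rw [dFun]
theorem d_true (w : List Bool) : d (true :: w) = true :: b w := by
  show dFun _ = _
  rw [dFun]; rfl
theorem a_nil : a [] = [] := rfl
theorem b_nil : b [] = [] := by
  show bFun _ = _
  rw [bFun]
theorem c_nil : c [] = [] := by
  show cFun _ = _
  rw [cFun]
theorem d_nil : d [] = [] := by
  show dFun _ = _
  rw [dFun]

/-- Every element of the group has a wreath decomposition with sections in the group. -/
theorem exists_sections (h : Equiv.Perm (List Bool)) (hh : h ∈ grigG) :
    ∃ (e : Bool) (s : Bool → Equiv.Perm (List Bool)), (∀ x, s x ∈ grigG) ∧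
      ∀ x w, h (x :: w) = (xor x e) :: s x w := by
  unfold grigG at hh
  induction hh using Subgroup.closure_induction with
  | mem x hx =>
    simp only [Set.mem_insert_iff, Set.mem_singleton_iff] at hx
    rcases hx with rfl | rfl | rfl | rfl
    · exact ⟨true, fun _ => 1, fun _ => one_mem _, fun x w => by simp [a_cons]⟩
    · refine ⟨false, fun x => if x then c else a, fun x => ?_, fun x w => ?_⟩
      · cases x <;> simp [mem_a, mem_c]
      · cases x <;> simp [b_false, b_true]
    · refine ⟨false, fun x => if x then d else a, fun x => ?_, fun x w => ?_⟩
      · cases x <;> simp [mem_a, mem_d]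
      · cases x <;> simp [c_false, c_true]
    · refine ⟨false, fun x => if x then b else 1, fun x => ?_, fun x w => ?_⟩
      · cases x <;> simp [mem_b, one_mem]
      · cases x <;> simp [d_false, d_true]
  | one => exact ⟨false, fun _ => 1, fun _ => one_mem _, fun x w => by simp⟩
  | mul g h _ _ ihg ihh =>
    obtain ⟨e, s, hs, he⟩ := ihg
    obtain ⟨e', s', hs', he'⟩ := ihh
    refine ⟨xor e' e, fun x => s (xor x e') * s' x, fun x => mul_mem (hs _) (hs' _), ?_⟩
    intro x w
    simp [he, he']
  | inv g _ ih =>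
    obtain ⟨e, s, hs, he⟩ := ih
    refine ⟨e, fun x => (s (xor x e))⁻¹, fun x => inv_mem (hs _), ?_⟩
    intro x w
    rw [Equiv.Perm.inv_eq_iff_eq, he]
    simp

theorem exists_lift (x : Bool) (g : Equiv.Perm (List Bool)) (hg : g ∈ grigG) :
    ∃ h ∈ grigG, h [false] = [false] ∧ h [true] = [true] ∧
        ∀ w : List Bool, h (x :: w) = x :: g w := by
  unfold grigG at hg
  induction hg using Subgroup.closure_induction with
  | mem g hg =>
    have hb := mul_mem (mul_mem mem_a mem_b) mem_a
    have hc := mul_mem (mul_mem mem_a mem_c) mem_a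
    have hd := mul_mem (mul_mem mem_a mem_d) mem_a
    simp only [Set.mem_insert_iff, Set.mem_singleton_iff] at hg
    rcases hg with rfl | rfl | rfl | rfl <;> cases x
    · exact ⟨b, mem_b, by simp [b_false, a_nil], by simp [b_true, c_nil], b_false⟩
    · refine ⟨_, hb, ?_, ?_, ?_⟩ <;> simp [a_cons, b_false, b_true, a_nil, c_nil]
    · refine ⟨_, hd, ?_, ?_, ?_⟩ <;> simp [a_cons, d_false, d_true, b_nil]
    · exact ⟨d, mem_d, by simp [d_false], by simp [d_true, b_nil], d_true⟩
    · refine ⟨_, hb, ?_, ?_, ?_⟩ <;> simp [a_cons, b_false, b_true, a_nil, c_nil]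
    · exact ⟨b, mem_b, by simp [b_false, a_nil], by simp [b_true, c_nil], b_true⟩
    · refine ⟨_, hc, ?_, ?_, ?_⟩ <;> simp [a_cons, c_false, c_true, a_nil, d_nil]
    · exact ⟨c, mem_c, by simp [c_false, a_nil], by simp [c_true, d_nil], c_true⟩
  | one => exact ⟨1, one_mem _, rfl, rfl, fun _ => rfl⟩
  | mul g g' _ _ ih ih' =>
    obtain ⟨h, hm, h0, h1, hw⟩ := ih
    obtain ⟨h', hm', h0', h1', hw'⟩ := ih'
    exact ⟨h * h', mul_mem hm hm', by simp [h0, h0'], by simp [h1, h1'],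
      fun w => by simp [hw, hw']⟩
  | inv g _ ih =>
    obtain ⟨h, hm, h0, h1, hw⟩ := ih
    refine ⟨h⁻¹, inv_mem hm, ?_, ?_, fun w => ?_⟩ <;> rw [Equiv.Perm.inv_eq_iff_eq]
    · exact h0.symm
    · exact h1.symm
    · rw [hw]; simp

/-- For every `h ∈ G` fixing the one-letter words `[0]` and `[1]`, the sections `h₀, h₁`
(characterized by `h (x :: w) = x :: h_x w`) belong to `G`; moreover every `g ∈ G` arises
as the `0`-section of some such `h ∈ G`, and as the `1`-section of some such `h' ∈ G`. -/
theorem sections_surjective :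
    (∀ h ∈ grigG, h [false] = [false] → h [true] = [true] →
      ∀ (x : Bool) (hx : Equiv.Perm (List Bool)),
        (∀ w : List Bool, h (x :: w) = x :: hx w) → hx ∈ grigG) ∧
    (∀ g ∈ grigG,
      (∃ h ∈ grigG, h [false] = [false] ∧ h [true] = [true] ∧
        ∀ w : List Bool, h (false :: w) = false :: g w) ∧
      (∃ h' ∈ grigG, h' [false] = [false] ∧ h' [true] = [true] ∧
        ∀ w : List Bool, h' (true :: w) = true :: g w)) := by
  refine ⟨?_, fun g hg => ⟨exists_lift false g hg, exists_lift true g hg⟩⟩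
  intro h hh _ _ x hx hw
  obtain ⟨e, s, hs, he⟩ := exists_sections h hh
  have : hx = s x := by
    ext1 w
    have := (hw w).symm.trans (he x w)
    exact (List.cons.inj this).2
  rw [this]
  exact hs x

end Grig
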